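/- arXiv:2509.01027 — 2 statements merged into one kernel-verified Lean document; each statement's English description precedes it below -/
import Mathlib

section
/- A set A of non-negative real numbers with 0 ∈ A is the distance set of some complete separable ultrametric space if and only if A is countable (finite or countably infinite). -/
/-- In a separable ultrametric space only countably many distances occur. -/
theorem IsUltrametricDist.countable_setOf_dist (X : Type*) [MetricSpace X]
    [TopologicalSpace.SeparableSpace X] [IsUltrametricDist X] :
    {r : ℝ | ∃ x y : X, dist x y = r}.Countable := by
  obtain ⟨D, hDc, hD⟩ := TopologicalSpace.exists_countable_dense X
  refine (((hDc.prod hDc).image fun p => dist p.1 p.2).insert 0).mono ?_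
  rintro r ⟨x, y, rfl⟩
  rcases eq_or_ne x y with rfl | hxy
  · simp
  have hpos := dist_pos.2 hxy
  obtain ⟨a, haD, ha⟩ := hD.exists_dist_lt x hpos
  obtain ⟨b, hbD, hb⟩ := hD.exists_dist_lt y hpos
  refine Or.inr ⟨(a, b), ⟨haD, hbD⟩, ?_⟩
  have hay : dist a y = dist x y := by
    have h := IsUltrametricDist.dist_eq_max_of_dist_ne_dist a x y (by rw [dist_comm a x]; exact ha.ne)
    rw [h, dist_comm a x, max_eq_right ha.le]
  have h := IsUltrametricDist.dist_eq_max_of_dist_ne_dist a y b (by rw [hay]; exact hb.ne')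
  change dist a b = dist x y
  rw [h, hay, max_eq_left hb.le]

/-- The ultrametric in which distinct points `x`, `y` lie at distance `max (f x) (f y)`, for an
injective nonnegative function `f`. -/
noncomputable abbrev MetricSpace.ofMax {X : Type*} (f : X → ℝ) (hf : Function.Injective f)
    (hnn : ∀ x, 0 ≤ f x) : MetricSpace X :=
  open scoped Classical in
  { dist := fun x y => if x = y then 0 else max (f x) (f y)
    dist_self := fun x => if_pos rfl
    dist_comm := fun x y => by grind
    dist_triangle := fun x y z => by
      have := hnn x
      have := hnn y
      have := hnn z
      grind
    eq_of_dist_eq_zero := fun {x y} h => by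
      have := hnn x
      have := hnn y
      by_contra hxy
      have := hf.ne hxy
      grind }

section OfMax

variable {X : Type*} (f : X → ℝ) (hf : Function.Injective f) (hnn : ∀ x, 0 ≤ f x)

open scoped Classical in
theorem MetricSpace.ofMax_dist (x y : X) :
    letI := MetricSpace.ofMax f hf hnn
    dist x y = if x = y then 0 else max (f x) (f y) :=
  rfl

theorem MetricSpace.ofMax_isUltrametricDist :
    letI := MetricSpace.ofMax f hf hnn
    IsUltrametricDist X := by
  let := MetricSpace.ofMax f hf hnn
  have hdist := MetricSpace.ofMax_dist f hf hnn
  refine ⟨fun x y z => ?_⟩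
  simp only [hdist]
  have := hnn x
  have := hnn y
  have := hnn z
  grind

open Filter Topology in
theorem MetricSpace.ofMax_completeSpace (o : X) (ho : f o = 0) :
    letI := MetricSpace.ofMax f hf hnn
    CompleteSpace X := by
  let := MetricSpace.ofMax f hf hnn
  have hdist := MetricSpace.ofMax_dist f hf hnn
  refine Metric.complete_of_cauchySeq_tendsto fun u hu => ?_
  by_cases h : ∀ ε > 0, ∃ N, ∀ n ≥ N, f (u n) < ε
  · refine ⟨o, Metric.tendsto_atTop.2 fun ε hε => ?_⟩
    obtain ⟨N, hN⟩ := h ε hε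
    refine ⟨N, fun n hn => ?_⟩
    have := hN n hn
    simp only [hdist]
    grind
  · push Not at h
    obtain ⟨ε, hε, h⟩ := h
    obtain ⟨N, hN⟩ := Metric.cauchySeq_iff.1 hu ε hε
    obtain ⟨n, hn, hun⟩ := h N
    refine ⟨u n, tendsto_const_nhds.congr' ?_⟩
    filter_upwards [eventually_ge_atTop N] with m hm
    have := hN m hm n hn
    simp only [hdist] at this
    grind

theorem MetricSpace.ofMax_setOf_dist (o : X) (ho : f o = 0) :
    letI := MetricSpace.ofMax f hf hnn
    {r : ℝ | ∃ x y : X, dist x y = r} = Set.range f := by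
  let := MetricSpace.ofMax f hf hnn
  have hdist := MetricSpace.ofMax_dist f hf hnn
  ext r
  constructor
  · rintro ⟨x, y, rfl⟩
    simp only [hdist]
    split_ifs
    · exact ⟨o, ho⟩
    · rcases max_choice (f x) (f y) with h | h <;> rw [h] <;> exact Set.mem_range_self _
  · rintro ⟨x, rfl⟩
    refine ⟨x, o, ?_⟩
    have := hnn x
    simp only [hdist]
    grind

end OfMax

/-- A set `A ⊆ [0,∞)` with `0 ∈ A` is the distance set of some complete
separable ultrametric space iff `A` is countable. -/
theorem stmt_3 (A : Set ℝ) (hnn : ∀ a ∈ A, 0 ≤ a) (h0 : (0 : ℝ) ∈ A) :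
    (∃ (X : Type) (_ : MetricSpace X), CompleteSpace X ∧ TopologicalSpace.SeparableSpace X ∧
      IsUltrametricDist X ∧ {r : ℝ | ∃ x y : X, dist x y = r} = A) ↔ A.Countable := by
  constructor
  · rintro ⟨X, _, _, _, _, rfl⟩
    exact IsUltrametricDist.countable_setOf_dist X
  · intro hA
    have hX : Countable A := hA.to_subtype
    have hinj : Function.Injective ((↑) : A → ℝ) := Subtype.val_injective
    have hnn' : ∀ x : A, 0 ≤ (x : ℝ) := fun x => hnn x x.2
    let m := MetricSpace.ofMax _ hinj hnn'
    refine ⟨A, m, MetricSpace.ofMax_completeSpace _ hinj hnn' ⟨0, h0⟩ rfl, ?_,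
      MetricSpace.ofMax_isUltrametricDist _ hinj hnn', ?_⟩
    · exact @TopologicalSpace.Countable.to_separableSpace A m.toUniformSpace.toTopologicalSpace hX
    · exact (MetricSpace.ofMax_setOf_dist _ hinj hnn' ⟨0, h0⟩ rfl).trans Subtype.range_coe
end

section
/- Let (X,d) be a compact metric space whose metric is an ultrametric. Then for every real b > 0, the set {d(x,y) : x,y ∈ X and d(x,y) ≥ b} is finite. -/
/-- In an ultrametric space, moving a point by less than its distance to `y` does not change
that distance. -/
theorem IsUltrametricDist.dist_eq_of_dist_lt {X : Type*} [PseudoMetricSpace X]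
    [IsUltrametricDist X] {x y z : X} (h : dist x z < dist x y) : dist z y = dist x y := by
  have h₁ := dist_triangle_max x z y
  have h₂ := dist_triangle_max z x y
  rw [dist_comm z x, max_eq_right h.le] at h₂
  exact le_antisymm h₂ ((le_max_iff.mp h₁).resolve_left h.not_ge)

/-- In a compact ultrametric space, for every `b > 0` the set of distances
that are at least `b` is finite. -/
theorem stmt_6 (X : Type*) [MetricSpace X] [CompactSpace X] [IsUltrametricDist X]
    (b : ℝ) (hb : 0 < b) :
    {r : ℝ | ∃ x y : X, dist x y = r ∧ b ≤ r}.Finite := by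
  obtain ⟨t, -, ht, hcover⟩ := finite_cover_balls_of_compact (isCompact_univ (X := X)) hb
  refine (ht.image2 dist ht).subset ?_
  rintro r ⟨x, y, rfl, hxy⟩
  obtain ⟨c, hc, hxc⟩ := Set.mem_iUnion₂.mp (hcover (Set.mem_univ x))
  obtain ⟨c', hc', hyc'⟩ := Set.mem_iUnion₂.mp (hcover (Set.mem_univ y))
  rw [Metric.mem_ball] at hxc hyc'
  have h₁ : dist c y = dist x y :=
    IsUltrametricDist.dist_eq_of_dist_lt (hxc.trans_le hxy)
  have h₂ : dist c' c = dist y c :=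
    IsUltrametricDist.dist_eq_of_dist_lt (hyc'.trans_le (by rwa [dist_comm y c, h₁]))
  exact ⟨c, hc, c', hc', by rw [dist_comm c c', h₂, dist_comm y c, h₁]⟩
end
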